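/- arXiv:quant-ph/0110125 — 2 statements merged into one kernel-verified Lean document; each statement's English description precedes it below -/
import Mathlib

section
/- (Exponential bound on the first-kind error.) For every real a, every n ≥ 1, and every s with 0 ≤ s ≤ 1, the test S̄_n(a) = {E_{σ_n}(ρ_n) − e^{na} σ_n > 0} satisfies α_n(S̄_n(a)) = Tr[ρ_n (I − S̄_n(a))] ≤ (n+1)^{sd} e^{n(as − ψ(s))}, where ψ(s) = −log Tr[ρ σ^{s/2} ρ^{−s} σ^{s/2}]. -/
open Matrix Filter
open scoped ComplexOrder

noncomputable section

/-- Functional calculus for a Hermitian matrix: apply `f` to the eigenvalues. -/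
def matFun {m : Type*} [Fintype m] [DecidableEq m] (f : ℝ → ℝ) (A : Matrix m m ℂ) :
    Matrix m m ℂ :=
  if hA : A.IsHermitian then
    (hA.eigenvectorUnitary : Matrix m m ℂ) *
      Matrix.diagonal (fun i => (f (hA.eigenvalues i) : ℂ)) *
      star (hA.eigenvectorUnitary : Matrix m m ℂ)
  else 0

/-- Matrix logarithm (via functional calculus). -/
def matLog {m : Type*} [Fintype m] [DecidableEq m] (A : Matrix m m ℂ) : Matrix m m ℂ :=
  matFun Real.log A

/-- Real matrix power (via functional calculus). -/
def matRPow {m : Type*} [Fintype m] [DecidableEq m] (A : Matrix m m ℂ) (s : ℝ) :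
    Matrix m m ℂ :=
  matFun (fun x => x ^ s) A

open Classical in
/-- The finite set of (distinct, real) eigenvalues of a Hermitian matrix. -/
def eigFinset {m : Type*} [Fintype m] [DecidableEq m] (A : Matrix m m ℂ) : Finset ℝ :=
  if hA : A.IsHermitian then Finset.image hA.eigenvalues Finset.univ else ∅

/-- `v A`: the number of distinct eigenvalues of a Hermitian matrix `A`. -/
def numEig {m : Type*} [Fintype m] [DecidableEq m] (A : Matrix m m ℂ) : ℕ :=
  (eigFinset A).card

/-- The spectral projection of a Hermitian matrix `A` corresponding to eigenvalue `μ`. -/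
def specProj {m : Type*} [Fintype m] [DecidableEq m] (A : Matrix m m ℂ) (μ : ℝ) :
    Matrix m m ℂ :=
  matFun (fun x => if x = μ then 1 else 0) A

/-- The pinching `E_A(B) = Σ_i E_i B E_i` of `B` by the Hermitian matrix `A`. -/
def pinch {m : Type*} [Fintype m] [DecidableEq m] (A B : Matrix m m ℂ) : Matrix m m ℂ :=
  ∑ μ ∈ eigFinset A, specProj A μ * B * specProj A μ

/-- `{X > 0}`: the projection onto the strictly positive eigenspaces of a Hermitian `X`. -/
def posProj {m : Type*} [Fintype m] [DecidableEq m] (X : Matrix m m ℂ) : Matrix m m ℂ :=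
  matFun (fun x => if 0 < x then 1 else 0) X

/-- The `n`-fold tensor (Kronecker) power of a `d × d` matrix, realized on the index type
`Fin n → Fin d`. -/
def tensorPow {d : ℕ} (ρ : Matrix (Fin d) (Fin d) ℂ) (n : ℕ) :
    Matrix (Fin n → Fin d) (Fin n → Fin d) ℂ :=
  fun x y => ∏ i, ρ (x i) (y i)

/-- A density matrix: positive semidefinite with unit trace. -/
def IsDensity {m : Type*} [Fintype m] [DecidableEq m] (ρ : Matrix m m ℂ) : Prop :=
  ρ.PosSemidef ∧ ρ.trace = 1

/-- A test: an operator `A` with `0 ≤ A ≤ I` in the Loewner order. -/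
def IsTest {m : Type*} [Fintype m] [DecidableEq m] (A : Matrix m m ℂ) : Prop :=
  A.PosSemidef ∧ (1 - A).PosSemidef

/-- The quantum relative entropy `D(ρ‖σ) = Tr[ρ (log ρ − log σ)]`. -/
def relEnt {m : Type*} [Fintype m] [DecidableEq m] (ρ σ : Matrix m m ℂ) : ℝ :=
  ((ρ * (matLog ρ - matLog σ)).trace).re

/-- The error probability of the first kind, `α_n(A) = Tr[ρ_n (I − A)]`. -/
def alphaErr {d : ℕ} (ρ : Matrix (Fin d) (Fin d) ℂ) (n : ℕ)
    (A : Matrix (Fin n → Fin d) (Fin n → Fin d) ℂ) : ℝ :=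
  ((tensorPow ρ n * (1 - A)).trace).re

/-- The error probability of the second kind, `β_n(A) = Tr[σ_n A]`. -/
def betaErr {d : ℕ} (σ : Matrix (Fin d) (Fin d) ℂ) (n : ℕ)
    (A : Matrix (Fin n → Fin d) (Fin n → Fin d) ℂ) : ℝ :=
  ((tensorPow σ n * A).trace).re

/-- `β*_n(ε)`: the minimum type-II error among tests with type-I error at most `ε`. -/
def betaStar {d : ℕ} (ρ σ : Matrix (Fin d) (Fin d) ℂ) (n : ℕ) (ε : ℝ) : ℝ :=
  sInf {b : ℝ | ∃ A : Matrix (Fin n → Fin d) (Fin n → Fin d) ℂ,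
    IsTest A ∧ alphaErr ρ n A ≤ ε ∧ b = betaErr σ n A}

namespace AlphaBound
open Polynomial

variable {m : Type*} [Fintype m] [DecidableEq m]

lemma matFun_def {A : Matrix m m ℂ} (hA : A.IsHermitian) (f : ℝ → ℝ) :
    matFun f A = (hA.eigenvectorUnitary : Matrix m m ℂ) *
      Matrix.diagonal (fun i => (f (hA.eigenvalues i) : ℂ)) *
      star (hA.eigenvectorUnitary : Matrix m m ℂ) := by
  simp [matFun, hA]

lemma matFun_congr {A : Matrix m m ℂ} (hA : A.IsHermitian) {f g : ℝ → ℝ}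
    (h : ∀ i, f (hA.eigenvalues i) = g (hA.eigenvalues i)) : matFun f A = matFun g A := by
  simp [matFun_def hA, h]

lemma aeval_conj_diag (V : Matrix m m ℂ) (hV : V ∈ unitary (Matrix m m ℂ)) (d : m → ℝ)
    (p : ℝ[X]) :
    aeval (V * Matrix.diagonal (fun i => (d i : ℂ)) * star V) p =
      V * Matrix.diagonal (fun i => ((p.eval (d i) : ℝ) : ℂ)) * star V := by
  have h1 : star V * V = 1 := (Unitary.mem_iff.mp hV).1
  have h2 : V * star V = 1 := (Unitary.mem_iff.mp hV).2
  induction p using Polynomial.induction_on with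
  | C a =>
    simp only [aeval_C, eval_C]
    have : Matrix.diagonal (fun _ : m => (a : ℂ)) = (a : ℂ) • (1 : Matrix m m ℂ) := by
      ext i j; simp [Matrix.diagonal_apply, Matrix.one_apply]
    rw [this]
    simp only [Algebra.mul_smul_comm, mul_one, Algebra.smul_mul_assoc, h2]
    rw [Algebra.algebraMap_eq_smul_one]
    ext i j; simp [Matrix.smul_apply]
  | add p q hp hq =>
    rw [map_add, hp, hq, ← add_mul, ← mul_add, Matrix.diagonal_add]
    simp
  | monomial n a ih =>
    rw [pow_succ, ← mul_assoc, map_mul, ih, aeval_X]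
    have e : ∀ X Y : Matrix m m ℂ, V * X * star V * (V * Y * star V) = V * (X * Y) * star V := by
      intro X Y
      calc _ = V * X * (star V * V) * Y * star V := by simp only [mul_assoc]
        _ = _ := by rw [h1]; simp only [mul_assoc, mul_one]
    rw [e, Matrix.diagonal_mul_diagonal]
    congr 3
    ext i
    simp

lemma interp (T : Finset ℝ) (f : ℝ → ℝ) : ∃ p : ℝ[X], ∀ x ∈ T, p.eval x = f x :=
  ⟨Lagrange.interpolate T id f, fun x hx => by
    simpa using Lagrange.eval_interpolate_at_node (v := id) (s := T) f (by simp) hx⟩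

lemma eig_decomp {A : Matrix m m ℂ} (hA : A.IsHermitian) :
    A = (hA.eigenvectorUnitary : Matrix m m ℂ) *
      Matrix.diagonal (fun i => (hA.eigenvalues i : ℂ)) *
      star (hA.eigenvectorUnitary : Matrix m m ℂ) := by
  have := hA.spectral_theorem
  rw [Unitary.conjStarAlgAut_apply] at this
  exact this

lemma matFun_eq_aeval {A : Matrix m m ℂ} (hA : A.IsHermitian) (f : ℝ → ℝ) (p : ℝ[X])
    (h : ∀ i, p.eval (hA.eigenvalues i) = f (hA.eigenvalues i)) : matFun f A = aeval A p := by
  conv_rhs => rw [eig_decomp hA]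
  rw [aeval_conj_diag _ hA.eigenvectorUnitary.2, matFun_def hA]
  simp [h]

lemma conj_herm (V : Matrix m m ℂ) (d : m → ℝ) :
    (V * Matrix.diagonal (fun i => (d i : ℂ)) * star V).IsHermitian := by
  unfold Matrix.IsHermitian
  simp only [Matrix.star_eq_conjTranspose, Matrix.conjTranspose_mul, Matrix.conjTranspose_conjTranspose, Matrix.diagonal_conjTranspose, mul_assoc]
  congr 3
  ext i
  simp

lemma matFun_herm {A : Matrix m m ℂ} (hA : A.IsHermitian) (f : ℝ → ℝ) :
    (matFun f A).IsHermitian := by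
  rw [matFun_def hA]; exact conj_herm _ _

lemma matFun_conj_diag (V : Matrix m m ℂ) (hV : V ∈ unitary (Matrix m m ℂ)) (d : m → ℝ)
    {A : Matrix m m ℂ} (h : A = V * Matrix.diagonal (fun i => (d i : ℂ)) * star V)
    (f : ℝ → ℝ) :
    matFun f A = V * Matrix.diagonal (fun i => (f (d i) : ℂ)) * star V := by
  have hA : A.IsHermitian := h ▸ conj_herm V d
  obtain ⟨p, hp⟩ := interp (Finset.image hA.eigenvalues Finset.univ ∪ Finset.image d Finset.univ) f
  rw [matFun_eq_aeval hA f p (fun i => hp _ (by simp)), h, aeval_conj_diag V hV]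
  congr 3
  ext i
  rw [hp (d i) (by simp)]

lemma matFun_mul {A : Matrix m m ℂ} (hA : A.IsHermitian) (f g : ℝ → ℝ) :
    matFun f A * matFun g A = matFun (fun x => f x * g x) A := by
  obtain ⟨p, hp⟩ := interp (Finset.image hA.eigenvalues Finset.univ) f
  obtain ⟨q, hq⟩ := interp (Finset.image hA.eigenvalues Finset.univ) g
  rw [matFun_eq_aeval hA f p (fun i => hp _ (by simp)),
    matFun_eq_aeval hA g q (fun i => hq _ (by simp)),
    matFun_eq_aeval hA _ (p * q) (fun i => by
      rw [eval_mul, hp _ (by simp), hq _ (by simp)]), map_mul]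

lemma matFun_add {A : Matrix m m ℂ} (hA : A.IsHermitian) (f g : ℝ → ℝ) :
    matFun f A + matFun g A = matFun (fun x => f x + g x) A := by
  rw [matFun_def hA, matFun_def hA, matFun_def hA, ← add_mul, ← mul_add, Matrix.diagonal_add]
  simp

lemma matFun_sub {A : Matrix m m ℂ} (hA : A.IsHermitian) (f g : ℝ → ℝ) :
    matFun f A - matFun g A = matFun (fun x => f x - g x) A := by
  rw [matFun_def hA, matFun_def hA, matFun_def hA, ← sub_mul, ← mul_sub, Matrix.diagonal_sub]
  simp

lemma matFun_id {A : Matrix m m ℂ} (hA : A.IsHermitian) : matFun (fun x => x) A = A := by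
  rw [matFun_eq_aeval hA _ X (fun i => by simp), aeval_X]

lemma matFun_one {A : Matrix m m ℂ} (hA : A.IsHermitian) : matFun (fun _ => 1) A = 1 := by
  rw [matFun_eq_aeval hA _ 1 (fun i => by simp), map_one]

lemma matFun_commute {A B : Matrix m m ℂ} (hA : A.IsHermitian) (h : Commute A B) (f : ℝ → ℝ) :
    Commute (matFun f A) B := by
  obtain ⟨p, hp⟩ := interp (Finset.image hA.eigenvalues Finset.univ) f
  rw [matFun_eq_aeval hA f p (fun i => hp _ (by simp))]
  clear hp
  induction p using Polynomial.induction_on with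
  | C a => rw [aeval_C]; exact Algebra.commutes a B
  | add p q hp hq => rw [map_add]; exact hp.add_left hq
  | monomial n a ih => rw [pow_succ, ← mul_assoc, map_mul, aeval_X]; exact ih.mul_left h

lemma matFun_posSemidef {A : Matrix m m ℂ} (hA : A.IsHermitian) {f : ℝ → ℝ}
    (h : ∀ i, 0 ≤ f (hA.eigenvalues i)) : (matFun f A).PosSemidef := by
  rw [matFun_def hA]
  exact (Matrix.PosSemidef.diagonal (fun i => by simpa using h i)).mul_mul_conjTranspose_same _

lemma matFun_smul {A : Matrix m m ℂ} (hA : A.IsHermitian) (c : ℝ) (f : ℝ → ℝ) :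
    matFun f ((c : ℂ) • A) = matFun (fun x => f (c * x)) A := by
  rw [matFun_def hA]
  refine matFun_conj_diag (hA.eigenvectorUnitary : Matrix m m ℂ) hA.eigenvectorUnitary.2
    (fun i => c * hA.eigenvalues i) ?_ f
  refine (congrArg (fun X => (c : ℂ) • X) (eig_decomp hA)).trans ?_
  rw [← Matrix.smul_mul, ← Matrix.mul_smul, ← Matrix.diagonal_smul]
  congr 3
  ext i
  simp

lemma matFun_const_mul {A : Matrix m m ℂ} (hA : A.IsHermitian) (c : ℝ) (f : ℝ → ℝ) :
    matFun (fun x => c * f x) A = (c : ℂ) • matFun f A := by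
  rw [matFun_def hA, matFun_def hA, ← Matrix.smul_mul, ← Matrix.mul_smul, ← Matrix.diagonal_smul]
  congr 3
  ext i
  simp

/-- powers of positive definite matrices are positive definite. -/
lemma rpow_posDef {A : Matrix m m ℂ} (hA : A.PosDef) (s : ℝ) : (matRPow A s).PosDef := by
  have hps : (matRPow A s).PosSemidef :=
    matFun_posSemidef hA.1 (fun i => (Real.rpow_pos_of_pos (hA.eigenvalues_pos i) s).le)
  rw [hps.posDef_iff_isUnit]
  refine IsUnit.of_mul_eq_one (matRPow A (-s)) ?_
  rw [matRPow, matRPow, matFun_mul hA.1, ← matFun_one hA.1]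
  refine matFun_congr hA.1 fun i => ?_
  have := hA.eigenvalues_pos i
  rw [← Real.rpow_add this]; simp

lemma rpow_mul_rpow {A : Matrix m m ℂ} (hA : A.PosDef) (s t : ℝ) :
    matRPow A s * matRPow A t = matRPow A (s + t) := by
  rw [matRPow, matRPow, matRPow, matFun_mul hA.1]
  refine matFun_congr hA.1 fun i => ?_
  rw [← Real.rpow_add (hA.eigenvalues_pos i)]

lemma rpow_zero {A : Matrix m m ℂ} (hA : A.IsHermitian) : matRPow A 0 = 1 := by
  simp [matRPow, matFun_one hA]

lemma rpow_smul {A : Matrix m m ℂ} (hA : A.PosDef) {c : ℝ} (hc : 0 ≤ c) (s : ℝ) :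
    matRPow ((c : ℂ) • A) s = ((c ^ s : ℝ) : ℂ) • matRPow A s := by
  rw [matRPow, matRPow, matFun_smul hA.1, ← matFun_const_mul hA.1]
  exact matFun_congr hA.1 fun i => Real.mul_rpow hc (hA.eigenvalues_pos i).le

section Order
open scoped Matrix.Norms.L2Operator MatrixOrder

lemma matFun_eq_cfc {A : Matrix m m ℂ} (hA : A.IsHermitian) (f : ℝ → ℝ) :
    matFun f A = cfc f A := by
  rw [hA.cfc_eq, matFun_def hA, Matrix.IsHermitian.cfc, Unitary.conjStarAlgAut_apply]
  rfl

lemma rpow_mono {A B : Matrix m m ℂ} (hA : A.PosSemidef) (hB : B.PosSemidef)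
    (h : (B - A).PosSemidef) {s : ℝ} (hs0 : 0 ≤ s) (hs1 : s ≤ 1) :
    (matRPow B s - matRPow A s).PosSemidef := by
  have := CFC.rpow_le_rpow (A := Matrix m m ℂ) (p := s) ⟨hs0, hs1⟩ (a := A) (b := B) h
  rw [CFC.rpow_eq_cfc_real hA.nonneg, CFC.rpow_eq_cfc_real hB.nonneg] at this
  rw [matRPow, matRPow, matFun_eq_cfc hA.1, matFun_eq_cfc hB.1]
  exact this

lemma inv_anti {A B A' B' : Matrix m m ℂ} (hA : A.PosDef) (hAA : A * A' = 1) (hBB : B * B' = 1)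
    (h : (B - A).PosSemidef) : (A' - B').PosSemidef :=
  CStarAlgebra.inv_le_inv (A := Matrix m m ℂ)
    (a := ⟨A, A', hAA, mul_eq_one_comm.mp hAA⟩) (b := ⟨B, B', hBB, mul_eq_one_comm.mp hBB⟩)
    hA.posSemidef.nonneg h

end Order

lemma rpow_anti {A B : Matrix m m ℂ} (hA : A.PosDef) (hB : B.PosDef)
    (h : (B - A).PosSemidef) {s : ℝ} (hs0 : 0 ≤ s) (hs1 : s ≤ 1) :
    (matRPow A (-s) - matRPow B (-s)).PosSemidef := by
  refine inv_anti (rpow_posDef hA s) ?_ ?_ (rpow_mono hA.posSemidef hB.posSemidef h hs0 hs1)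
  · rw [rpow_mul_rpow hA, add_neg_cancel, rpow_zero hA.1]
  · rw [rpow_mul_rpow hB, add_neg_cancel, rpow_zero hB.1]

lemma aeval_proj_mul {P A : Matrix m m ℂ} (hc : Commute P A) (hP : P * P = P) (p : ℝ[X])
    (h0 : p.eval 0 = 0) : aeval (P * A) p = P * aeval A p := by
  obtain ⟨q, rfl⟩ : X ∣ p := by
    rw [Polynomial.X_dvd_iff, Polynomial.coeff_zero_eq_eval_zero]; exact h0
  clear h0
  have hk : ∀ q : ℝ[X], P * aeval (P * A) q = P * aeval A q := by
    intro q
    induction q using Polynomial.induction_on with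
    | C a => simp
    | add p q hp hq => rw [map_add, map_add, mul_add, mul_add, hp, hq]
    | monomial n a ih =>
      rw [pow_succ, ← mul_assoc, map_mul _ _ X, map_mul _ _ X, aeval_X, aeval_X, ← mul_assoc, ih, ← mul_assoc,
        mul_assoc P _ P]
      have hcP : Commute P (aeval A (C a * X ^ n)) := by
        rw [map_mul, aeval_C, map_pow, aeval_X]
        exact (show Commute P _ from (Algebra.commutes a P).symm).mul_right (hc.pow_right n)
      rw [← hcP.eq, ← mul_assoc P P, hP, mul_assoc]
  rw [map_mul, map_mul, aeval_X, aeval_X, hc.eq, mul_assoc, ← hc.eq, hk, ← mul_assoc, ← mul_assoc,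
    hc.eq]

lemma rpow_proj_mul {P A : Matrix m m ℂ} (hA : A.IsHermitian) (hPA : (P * A).IsHermitian)
    (hc : Commute P A) (hP : P * P = P) {s : ℝ} (hs : 0 < s) :
    matRPow (P * A) s = P * matRPow A s := by
  obtain ⟨p, hp⟩ := interp (Finset.image hA.eigenvalues Finset.univ ∪
    Finset.image hPA.eigenvalues Finset.univ ∪ {0}) (fun x => x ^ s)
  rw [matRPow, matRPow, matFun_eq_aeval hA _ p (fun i => hp _ (by simp)),
    matFun_eq_aeval hPA _ p (fun i => hp _ (by simp))]
  apply aeval_proj_mul hc hP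
  rw [hp 0 (by simp), Real.zero_rpow hs.ne']

lemma one_sub_posProj {H : Matrix m m ℂ} (hH : H.IsHermitian) :
    1 - posProj H = matFun (fun x => if 0 < x then 0 else 1) H := by
  rw [posProj, ← matFun_one hH, matFun_sub hH]
  refine matFun_congr hH fun i => ?_
  split_ifs <;> simp

lemma conj_alg {A B P : Matrix m m ℂ} (hA : A.PosDef) (hB : B.PosDef) (hAB : Commute A B)
    (hcA : Commute P A) (s : ℝ) :
    matRPow B (s / 2) * matRPow A (-s) * matRPow B (s / 2) - P =
      matRPow A (-(s / 2)) * (matRPow B s - P * matRPow A s) * matRPow A (-(s / 2)) := by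
  have c1 : Commute (matRPow A (-(s / 2))) P := matFun_commute hA.1 hcA.symm _
  have c2 : Commute (matRPow A (-(s / 2))) (matRPow B (s / 2)) :=
    matFun_commute hA.1 (matFun_commute hB.1 hAB.symm _).symm _
  have e1 : matRPow A (-s) = matRPow A (-(s / 2)) * matRPow A (-(s / 2)) := by
    rw [rpow_mul_rpow hA]; congr 1; ring
  have e2 : matRPow B s = matRPow B (s / 2) * matRPow B (s / 2) := by
    rw [rpow_mul_rpow hB]; congr 1; ring
  have e3 : matRPow A (-(s / 2)) * matRPow A s * matRPow A (-(s / 2)) = 1 := by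
    rw [rpow_mul_rpow hA, rpow_mul_rpow hA, show -(s / 2) + s + -(s / 2) = 0 by ring,
      rpow_zero hA.1]
  rw [e1, e2, mul_sub, sub_mul]
  generalize matRPow A (-(s / 2)) = a at *
  generalize matRPow B (s / 2) = b at *
  generalize matRPow A s = c at *
  congr 1
  · calc _ = b * a * (a * b) := by simp only [mul_assoc]
      _ = (a * b) * (b * a) := by rw [c2.eq]
      _ = _ := by simp only [mul_assoc]
  · rw [← mul_assoc, c1.eq, mul_assoc P, mul_assoc P, e3, mul_one]

/-- The key operator inequality. -/
lemma proj_le {A B : Matrix m m ℂ} (hA : A.PosDef) (hB : B.PosDef) (hAB : Commute A B)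
    {s : ℝ} (hs0 : 0 ≤ s) (hs1 : s ≤ 1) :
    (matRPow B (s / 2) * matRPow A (-s) * matRPow B (s / 2) -
      (1 - posProj (A - B))).PosSemidef := by
  have hH : (A - B).IsHermitian := hA.1.sub hB.1
  rw [one_sub_posProj hH]
  obtain ⟨P, hPdef⟩ : ∃ P, P = matFun (fun x => if 0 < x then 0 else 1) (A - B) := ⟨_, rfl⟩
  rw [← hPdef]
  have hPh : P.IsHermitian := by rw [hPdef]; exact matFun_herm hH _
  have hPP : P * P = P := by
    rw [hPdef, matFun_mul hH]
    refine matFun_congr hH fun i => ?_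
    split_ifs <;> simp
  have hcA : Commute P A := by
    rw [hPdef]; exact matFun_commute hH ((Commute.refl A).sub_left hAB.symm) _
  have hcB : Commute P B := by
    rw [hPdef]; exact matFun_commute hH (hAB.sub_left (Commute.refl B)) _
  have hQ : (1 - P).PosSemidef := by
    rw [hPdef, ← matFun_one hH, matFun_sub hH]
    refine matFun_posSemidef hH fun i => ?_
    split_ifs <;> simp
  have hQQ : (1 - P) * (1 - P) = 1 - P := by
    rw [mul_sub, sub_mul, sub_mul, hPP]; simp
  have hneg : (P * (B - A)).PosSemidef := by
    have : P * (B - A) = matFun (fun x => if 0 < x then 0 else -x) (A - B) := by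
      have e : B - A = matFun (fun x => 0 - x) (A - B) := by
        rw [← matFun_sub hH, matFun_id hH]
        have : matFun (fun _ => (0:ℝ)) (A - B) = 0 := by rw [matFun_def hH]; simp
        rw [this]; simp
      rw [e, hPdef, matFun_mul hH]
      refine matFun_congr hH fun i => ?_
      split_ifs <;> simp
    rw [this]
    refine matFun_posSemidef hH fun i => ?_
    split_ifs with h
    · simp
    · linarith
  rcases hs0.eq_or_lt with rfl | hs
  · simpa [rpow_zero hA.1, rpow_zero hB.1] using hQ
  have hPA : (P * A).PosSemidef := by
    have := hA.posSemidef.mul_mul_conjTranspose_same P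
    rw [hPh.eq, mul_assoc, ← hcA.eq, ← mul_assoc, hPP] at this
    exact this
  have hQB : ((1 - P) * B).PosSemidef := by
    have := hB.posSemidef.mul_mul_conjTranspose_same (1 - P)
    have hc : Commute (1 - P) B := (Commute.one_left B).sub_left hcB
    rw [hQ.1.eq, mul_assoc, ← hc.eq, ← mul_assoc, hQQ] at this
    exact this
  have hle : (B - P * A).PosSemidef := by
    have := hneg.add hQB
    convert this using 1
    noncomm_ring
  have h1 := rpow_mono hPA hB.posSemidef hle hs0 hs1
  rw [rpow_proj_mul hA.1 hPA.1 hcA hPP hs] at h1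
  have hX := rpow_posDef hA (-(s / 2))
  have h2 := h1.mul_mul_conjTranspose_same (matRPow A (-(s / 2)))
  rw [hX.1.eq] at h2
  rw [conj_alg hA hB hAB hcA s]
  exact h2

section pinching

lemma mem_eigFinset {A : Matrix m m ℂ} (hA : A.IsHermitian) {x : ℝ} : x ∈ eigFinset A ↔ ∃ i, hA.eigenvalues i = x := by
  simp [eigFinset, hA]

lemma specProj_herm {A : Matrix m m ℂ} (hA : A.IsHermitian) (x : ℝ) : (specProj A x)ᴴ = specProj A x := (matFun_herm hA _).eq

lemma sum_specProj {A : Matrix m m ℂ} (hA : A.IsHermitian) : ∑ x ∈ eigFinset A, specProj A x = 1 := by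
  have : ∀ T : Finset ℝ, ∑ x ∈ T, specProj A x = matFun (fun y => if y ∈ T then 1 else 0) A := by
    intro T
    induction T using Finset.induction_on with
    | empty => simp [matFun_def hA]
    | insert a T ha ih =>
      rw [Finset.sum_insert ha, ih, specProj, matFun_add hA]
      refine matFun_congr hA fun i => ?_
      by_cases h1 : hA.eigenvalues i = a
      · simp [h1, ha]
      · simp [h1]
  rw [this, ← matFun_one hA]
  refine matFun_congr hA fun i => ?_
  rw [if_pos]
  exact (mem_eigFinset hA).2 ⟨i, rfl⟩

lemma specProj_mul {A : Matrix m m ℂ} (hA : A.IsHermitian) (x : ℝ) : specProj A x * A = (x : ℂ) • specProj A x := by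
  refine (congrArg (fun X => specProj A x * X) (matFun_id hA).symm).trans ?_
  rw [specProj, matFun_mul hA, ← matFun_const_mul hA]
  refine matFun_congr hA fun i => ?_
  split_ifs with h <;> simp [h]

lemma mul_specProj {A : Matrix m m ℂ} (hA : A.IsHermitian) (x : ℝ) : A * specProj A x = (x : ℂ) • specProj A x := by
  rw [← specProj_mul hA, specProj]
  exact (matFun_commute hA (Commute.refl A) _).symm.eq

lemma pinch_commute {A : Matrix m m ℂ} (hA : A.IsHermitian) (B : Matrix m m ℂ) : Commute (pinch A B) A := by
  refine Commute.sum_left _ _ _ fun x _ => ?_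
  unfold Commute SemiconjBy
  rw [mul_assoc, specProj_mul hA, mul_assoc (specProj A x) B (specProj A x), ← mul_assoc A, mul_specProj hA]
  simp [mul_assoc]

lemma pinch_ineq {A : Matrix m m ℂ} (hA : A.IsHermitian) {B : Matrix m m ℂ} (hB : B.PosSemidef) :
    (((numEig A : ℝ) : ℂ) • pinch A B - B).PosSemidef := by
  set T := eigFinset A with hT
  set E := specProj A with hE
  have h1 : (∑ x ∈ T, ∑ y ∈ T, (E x - E y) * B * (E x - E y)).PosSemidef := by
    refine Matrix.posSemidef_sum _ fun x _ => Matrix.posSemidef_sum _ fun y _ => ?_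
    have := hB.mul_mul_conjTranspose_same (E x - E y)
    rwa [Matrix.conjTranspose_sub, specProj_herm hA, specProj_herm hA] at this
  have h2 : ∑ x ∈ T, ∑ y ∈ T, (E x - E y) * B * (E x - E y) =
      (2 : ℂ) • (((numEig A : ℝ) : ℂ) • pinch A B - B) := by
    have e1 : ∀ x y, (E x - E y) * B * (E x - E y) =
      E x * B * E x - E x * B * E y - E y * B * E x + E y * B * E y := by
      intro x y; noncomm_ring
    have hs : ∑ x ∈ T, E x = 1 := sum_specProj hA
    have e2 : ∑ x ∈ T, ∑ y ∈ T, E x * B * E y = B := by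
      simp_rw [← Finset.mul_sum, hs, mul_one, ← Finset.sum_mul, hs, one_mul]
    have e3 : ∑ x ∈ T, ∑ y ∈ T, E y * B * E x = B := by
      rw [Finset.sum_comm]; exact e2
    simp_rw [e1, Finset.sum_add_distrib, Finset.sum_sub_distrib, e2, e3, Finset.sum_const]
    rw [← Finset.smul_sum, numEig, pinch, ← hT, ← hE, two_smul]
    simp only [Complex.ofReal_natCast, Nat.cast_smul_eq_nsmul]
    abel
  rw [h2] at h1
  have := h1.smul (α := ℂ) (a := (1/2 : ℂ)) (by norm_num [Complex.le_def])
  rw [smul_smul] at this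
  simpa using this

end pinching

section tensor
variable {d : ℕ}

lemma tensorPow_mul (A B : Matrix (Fin d) (Fin d) ℂ) (n : ℕ) :
    tensorPow (A * B) n = tensorPow A n * tensorPow B n := by
  ext x y
  simp only [tensorPow, Matrix.mul_apply, ← Finset.prod_mul_distrib]
  rw [Finset.prod_univ_sum, Fintype.piFinset_univ]

lemma tensorPow_star (A : Matrix (Fin d) (Fin d) ℂ) (n : ℕ) :
    tensorPow (star A) n = star (tensorPow A n) := by
  ext x y
  simp [tensorPow, Matrix.star_apply]

lemma tensorPow_diagonal (D : Fin d → ℂ) (n : ℕ) :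
    tensorPow (Matrix.diagonal D) n = Matrix.diagonal (fun x => ∏ i, D (x i)) := by
  ext x y
  rw [Matrix.diagonal_apply, tensorPow]
  split_ifs with h
  · subst h; simp
  · obtain ⟨i, hi⟩ := Function.ne_iff.mp h
    exact Finset.prod_eq_zero (Finset.mem_univ i) (by simp [hi])

lemma tensorPow_one (n : ℕ) : tensorPow (1 : Matrix (Fin d) (Fin d) ℂ) n = 1 := by
  rw [← Matrix.diagonal_one, tensorPow_diagonal]; simp

lemma tensorPow_trace (A : Matrix (Fin d) (Fin d) ℂ) (n : ℕ) :
    (tensorPow A n).trace = A.trace ^ n := by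
  simp only [Matrix.trace, Matrix.diag, tensorPow]
  have := Finset.prod_univ_sum (fun _ : Fin n => (Finset.univ : Finset (Fin d)))
    (fun _ j => A j j)
  rw [Fintype.piFinset_univ] at this
  rw [← this]; simp

lemma tensorPow_unitary {U : Matrix (Fin d) (Fin d) ℂ}
    (hU : U ∈ unitary (Matrix (Fin d) (Fin d) ℂ)) (n : ℕ) :
    tensorPow U n ∈ unitary (Matrix (Fin n → Fin d) (Fin n → Fin d) ℂ) := by
  rw [Unitary.mem_iff] at hU ⊢
  rw [← tensorPow_star, ← tensorPow_mul, ← tensorPow_mul, hU.1, hU.2, tensorPow_one]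
  exact ⟨rfl, rfl⟩

lemma tensorPow_decomp {A : Matrix (Fin d) (Fin d) ℂ} (hA : A.IsHermitian) (n : ℕ) :
    tensorPow A n = tensorPow (hA.eigenvectorUnitary : Matrix (Fin d) (Fin d) ℂ) n *
      Matrix.diagonal (fun x => ((∏ i, hA.eigenvalues (x i) : ℝ) : ℂ)) *
      star (tensorPow (hA.eigenvectorUnitary : Matrix (Fin d) (Fin d) ℂ) n) := by
  refine (congrArg (fun X => tensorPow X n) (eig_decomp hA)).trans ?_
  rw [tensorPow_mul, tensorPow_mul, tensorPow_star, tensorPow_diagonal]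
  simp

lemma tensorPow_herm {A : Matrix (Fin d) (Fin d) ℂ} (hA : A.IsHermitian) (n : ℕ) :
    (tensorPow A n).IsHermitian := by
  rw [tensorPow_decomp hA]; exact conj_herm _ _

lemma matFun_tensorPow {A : Matrix (Fin d) (Fin d) ℂ} (hA : A.IsHermitian) (n : ℕ) (f : ℝ → ℝ) :
    matFun f (tensorPow A n) =
      tensorPow (hA.eigenvectorUnitary : Matrix (Fin d) (Fin d) ℂ) n *
      Matrix.diagonal (fun x => ((f (∏ i, hA.eigenvalues (x i)) : ℝ) : ℂ)) *
      star (tensorPow (hA.eigenvectorUnitary : Matrix (Fin d) (Fin d) ℂ) n) :=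
  matFun_conj_diag _ (tensorPow_unitary hA.eigenvectorUnitary.2 n) _ (tensorPow_decomp hA n) f

lemma rpow_tensorPow {A : Matrix (Fin d) (Fin d) ℂ} (hA : A.PosDef) (n : ℕ) (s : ℝ) :
    matRPow (tensorPow A n) s = tensorPow (matRPow A s) n := by
  rw [matRPow, matRPow, matFun_tensorPow hA.1, matFun_def hA.1, tensorPow_mul, tensorPow_mul,
    tensorPow_star, tensorPow_diagonal]
  congr 3
  ext x
  rw [← Real.finsetProd_rpow _ _ (fun i _ => (hA.eigenvalues_pos (x i)).le)]
  simp

lemma tensorPow_posDef {A : Matrix (Fin d) (Fin d) ℂ} (hA : A.PosDef) (n : ℕ) :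
    (tensorPow A n).PosDef := by
  have hV := tensorPow_unitary hA.1.eigenvectorUnitary.2 n
  rw [tensorPow_decomp hA.1]
  refine Matrix.PosDef.mul_mul_conjTranspose_same (Matrix.PosDef.diagonal fun x => ?_) ?_
  · exact_mod_cast Finset.prod_pos fun i _ => hA.eigenvalues_pos (x i)
  · rw [Matrix.vecMul_injective_iff_isUnit]
    exact IsUnit.of_mul_eq_one _ (Unitary.mem_iff.mp hV).2

lemma numEig_tensorPow {A : Matrix (Fin d) (Fin d) ℂ} (hA : A.IsHermitian) (n : ℕ) :
    numEig (tensorPow A n) ≤ (n + 1) ^ d := by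
  classical
  have hn := tensorPow_herm hA n
  have hsub : eigFinset (tensorPow A n) ⊆
      Finset.image (fun k : Fin d → Fin (n + 1) => ∏ j, hA.eigenvalues j ^ (k j : ℕ))
        Finset.univ := by
    intro μ hμ
    have hx : ∃ x : Fin n → Fin d, ∏ i, hA.eigenvalues (x i) = μ := by
      by_contra hcon
      push Not at hcon
      have h0 : specProj (tensorPow A n) μ = 0 := by
        rw [specProj, matFun_tensorPow hA]
        simp [hcon]
      obtain ⟨i, hi⟩ := (mem_eigFinset hn).1 hμ
      rw [specProj, matFun_def hn] at h0
      have hU := Unitary.mem_iff.mp hn.eigenvectorUnitary.2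
      have h1 := congrArg (fun X => star (hn.eigenvectorUnitary : Matrix _ _ ℂ) * X *
        (hn.eigenvectorUnitary : Matrix _ _ ℂ)) h0
      simp only [mul_assoc, hU.1, mul_one, mul_zero, zero_mul] at h1
      rw [← mul_assoc, hU.1, one_mul] at h1
      have h2 := congrFun (congrFun h1 i) i
      simp [hi] at h2
    obtain ⟨x, rfl⟩ := hx
    refine Finset.mem_image.2 ⟨fun j => ⟨(Finset.univ.filter (fun i => x i = j)).card, ?_⟩,
      Finset.mem_univ _, ?_⟩
    · have := Finset.card_le_univ (Finset.univ.filter (fun i => x i = j))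
      rw [Fintype.card_fin] at this
      omega
    · simp only
      rw [← Finset.prod_fiberwise' Finset.univ x hA.eigenvalues]
      simp
  calc numEig (tensorPow A n) ≤ _ := Finset.card_le_card hsub
    _ ≤ _ := Finset.card_image_le
    _ = _ := by simp

end tensor

lemma trace_mul_nonneg {A B : Matrix m m ℂ} (hA : A.PosDef) (hB : B.PosSemidef) :
    0 ≤ (A * B).trace := by
  have e : A = matRPow A (1 / 2) * matRPow A (1 / 2) := by
    rw [rpow_mul_rpow hA, matRPow]; norm_num; exact (matFun_id hA.1).symm
  rw [e, mul_assoc, Matrix.trace_mul_comm]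
  have := hB.mul_mul_conjTranspose_same (matRPow A (1 / 2))
  rw [(rpow_posDef hA _).1.eq] at this
  exact this.trace_nonneg

lemma trace_mul_pos [Nonempty m] {A B : Matrix m m ℂ} (hA : A.PosDef) (hB : B.PosDef) :
    0 < (A * B).trace := by
  have e : A = matRPow A (1 / 2) * matRPow A (1 / 2) := by
    rw [rpow_mul_rpow hA, matRPow]; norm_num; exact (matFun_id hA.1).symm
  rw [e, mul_assoc, Matrix.trace_mul_comm]
  have := hB.mul_mul_conjTranspose_same (B := matRPow A (1 / 2)) (by
    rw [Matrix.vecMul_injective_iff_isUnit]; exact (rpow_posDef hA _).isUnit)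
  rw [(rpow_posDef hA _).1.eq] at this
  exact this.trace_pos

lemma conj_posDef {A B : Matrix m m ℂ} (hA : A.PosDef) (hB : B.PosDef) :
    (A * B * A).PosDef := by
  have := hB.mul_mul_conjTranspose_same (B := A) (by
    rw [Matrix.vecMul_injective_iff_isUnit]; exact hA.isUnit)
  rwa [hA.1.eq] at this

/-- The single-shot bound. -/
lemma one_shot [Nonempty m] {R S : Matrix m m ℂ} (hR : R.PosDef) (hS : S.PosDef) {c : ℝ} (hc : 0 < c)
    {s : ℝ} (hs0 : 0 ≤ s) (hs1 : s ≤ 1) :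
    ((R * (1 - posProj (pinch S R - (c : ℂ) • S))).trace).re ≤
      c ^ s * (numEig S : ℝ) ^ s *
        ((R * (matRPow S (s / 2) * matRPow R (-s) * matRPow S (s / 2))).trace).re := by
  have hpi := pinch_ineq hS.1 hR.posSemidef
  have hv : (0 : ℝ) < numEig S := by
    have : (eigFinset S).Nonempty :=
      ⟨_, (mem_eigFinset hS.1).2 ⟨Classical.arbitrary m, rfl⟩⟩
    exact_mod_cast this.card_pos
  generalize (numEig S : ℝ) = v at *
  have hvP : ((v : ℂ) • pinch S R).PosDef := by
    have := hR.add_posSemidef hpi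
    simpa using this
  have hP : (pinch S R).PosDef := by
    have := hvP.smul (α := ℂ) (a := ((v⁻¹ : ℝ) : ℂ)) (by exact_mod_cast inv_pos.2 hv)
    rw [smul_smul, ← Complex.ofReal_mul, inv_mul_cancel₀ hv.ne'] at this
    simpa using this
  have hcS : ((c : ℂ) • S).PosDef := hS.smul (by exact_mod_cast hc)
  have h1 := proj_le hP hcS ((pinch_commute hS.1 R).smul_right (c : ℂ)) hs0 hs1
  have h2 := rpow_anti hR hvP hpi hs0 hs1
  rw [rpow_smul hP hv.le] at h2
  rw [rpow_smul hS hc.le] at h1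
  have t1 := trace_mul_nonneg hR h1
  have h3 := h2.mul_mul_conjTranspose_same (matRPow S (s / 2))
  rw [(rpow_posDef hS _).1.eq] at h3
  have t2 := trace_mul_nonneg hR h3
  simp only [mul_sub, sub_mul, Matrix.trace_sub, Matrix.smul_mul, Matrix.mul_smul,
    Matrix.trace_smul, smul_eq_mul, mul_one] at t1 t2 ⊢
  have r1 := (Complex.le_def.1 t1).1
  have r2 := (Complex.le_def.1 t2).1
  simp only [Complex.sub_re, Complex.re_ofReal_mul, Complex.zero_re] at r1 r2 ⊢
  have hcc : c ^ s = c ^ (s / 2) * c ^ (s / 2) := by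
    rw [← Real.rpow_add hc]; congr 1; ring
  rw [Real.rpow_neg hv.le] at r2
  have hvs : 0 < v ^ s := Real.rpow_pos_of_pos hv s
  have hcs : 0 < c ^ s := Real.rpow_pos_of_pos hc s
  rw [← mul_assoc, ← hcc] at r1
  set p := ((R * (matRPow S (s / 2) * matRPow (pinch S R) (-s) * matRPow S (s / 2))).trace).re
  set q := ((R * (matRPow S (s / 2) * matRPow R (-s) * matRPow S (s / 2))).trace).re
  have r3 : p ≤ v ^ s * q := by
    have := mul_le_mul_of_nonneg_left (sub_nonneg.1 r2) hvs.le
    rwa [← mul_assoc, mul_inv_cancel₀ hvs.ne', one_mul] at this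
  have r4 := mul_le_mul_of_nonneg_left r3 hcs.le
  rw [← mul_assoc] at r4
  linarith

end AlphaBound

/-- **Exponential bound on the first-kind error** of the test
`S̄_n(a) = {E_{σ_n}(ρ_n) − e^{na} σ_n > 0}`. -/
theorem alpha_exponential_bound {d : ℕ} (hd : 0 < d) (ρ σ : Matrix (Fin d) (Fin d) ℂ)
    (hρ : IsDensity ρ) (hσ : IsDensity σ) (hρpd : ρ.PosDef) (hσpd : σ.PosDef)
    (a : ℝ) (n : ℕ) (hn : 1 ≤ n) (s : ℝ) (hs0 : 0 ≤ s) (hs1 : s ≤ 1) :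
    alphaErr ρ n (posProj (pinch (tensorPow σ n) (tensorPow ρ n)
        - (Real.exp (n * a) : ℂ) • tensorPow σ n))
      ≤ ((n : ℝ) + 1) ^ (s * (d : ℝ)) *
        Real.exp ((n : ℝ) * (a * s -
          (-Real.log ((ρ * matRPow σ (s / 2) * matRPow ρ (-s) * matRPow σ (s / 2)).trace.re)))) := by
  haveI : Nonempty (Fin d) := ⟨⟨0, hd⟩⟩
  have h1 := AlphaBound.one_shot (AlphaBound.tensorPow_posDef hρpd n)
    (AlphaBound.tensorPow_posDef hσpd n) (Real.exp_pos (n * a)) hs0 hs1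
  have hT := AlphaBound.trace_mul_pos hρpd (AlphaBound.conj_posDef
    (AlphaBound.rpow_posDef hσpd (s / 2)) (AlphaBound.rpow_posDef hρpd (-s)))
  rw [AlphaBound.rpow_tensorPow hσpd, AlphaBound.rpow_tensorPow hρpd, ← AlphaBound.tensorPow_mul,
    ← AlphaBound.tensorPow_mul, ← AlphaBound.tensorPow_mul, AlphaBound.tensorPow_trace] at h1
  rw [mul_assoc ρ, mul_assoc ρ]
  unfold alphaErr
  refine h1.trans ?_
  obtain ⟨hre, him⟩ := Complex.lt_def.1 hT
  generalize (ρ * (matRPow σ (s / 2) * matRPow ρ (-s) * matRPow σ (s / 2))).trace = z at *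
  have hz : z = ((z.re : ℝ) : ℂ) := by
    apply Complex.ext <;> simp at him ⊢
    exact him.symm
  have hzn : (z ^ n).re = z.re ^ n := by
    rw [hz, ← Complex.ofReal_pow, Complex.ofReal_re, Complex.ofReal_re]
  rw [hzn]
  have hre' : 0 < z.re := by simpa using hre
  have hexp : Real.exp ((n : ℝ) * (a * s - -Real.log z.re)) =
      Real.exp (n * a) ^ s * z.re ^ n := by
    rw [← Real.exp_mul, ← Real.exp_log hre', ← Real.exp_nat_mul, ← Real.exp_add, Real.log_exp]
    congr 1; ring
  rw [hexp]
  have hv : (numEig (tensorPow σ n) : ℝ) ^ s ≤ ((n : ℝ) + 1) ^ (s * (d : ℝ)) := by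
    rw [mul_comm, Real.rpow_mul (by positivity), Real.rpow_natCast]
    refine Real.rpow_le_rpow (by positivity) ?_ hs0
    exact_mod_cast AlphaBound.numEig_tensorPow hσpd.1 n
  have hpos : 0 ≤ Real.exp (n * a) ^ s * z.re ^ n := by positivity
  calc _ = (numEig (tensorPow σ n) : ℝ) ^ s * (Real.exp (n * a) ^ s * z.re ^ n) := by ring
    _ ≤ _ := mul_le_mul_of_nonneg_right hv hpos

end
end

section
/- (Negative-power inequality for the pinching.) For every s with 0 ≤ s ≤ 1 and every n ≥ 1, E_{σ_n}(ρ_n)^{−s} ≤ v(σ_n)^s · ρ_n^{−s} in the Loewner order, where v(σ_n) is the number of distinct eigenvalues of σ_n. -/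
open Matrix Filter
open scoped ComplexOrder

noncomputable section

open scoped MatrixOrder Matrix.Norms.L2Operator in
lemma matFun_eq_cfc {m : Type*} [Fintype m] [DecidableEq m] (f : ℝ → ℝ) {A : Matrix m m ℂ}
    (hA : A.IsHermitian) : matFun f A = cfc f A := by
  rw [hA.cfc_eq, matFun, dif_pos hA, Matrix.IsHermitian.cfc, Unitary.conjStarAlgAut_apply]
  rfl

open scoped MatrixOrder Matrix.Norms.L2Operator in
lemma matRPow_eq_rpow {m : Type*} [Fintype m] [DecidableEq m] (s : ℝ) {A : Matrix m m ℂ}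
    (hA : A.PosSemidef) : matRPow A s = A ^ s := by
  rw [matRPow, matFun_eq_cfc _ hA.1, CFC.rpow_eq_cfc_real hA.nonneg]

open scoped MatrixOrder Matrix.Norms.L2Operator in
lemma neg_power_of_le {m : Type*} [Fintype m] [DecidableEq m] {A B : Matrix m m ℂ}
    (hB : B.PosDef) {v : ℝ} (hv : 0 < v) (h : ((v : ℂ) • A - B).PosSemidef)
    {s : ℝ} (hs0 : 0 ≤ s) (hs1 : s ≤ 1) :
    (((v ^ s : ℝ) : ℂ) • matRPow B (-s) - matRPow A (-s)).PosSemidef := by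
  have h1 : B ≤ v • A := by
    rw [Matrix.le_iff]; exact h
  have hB' : IsStrictlyPositive B := hB.isStrictlyPositive
  have hvA : IsStrictlyPositive (v • A) := hB'.of_le h1
  have hA0 : 0 ≤ A := by
    have := smul_nonneg (inv_nonneg.2 hv.le) hvA.nonneg
    rwa [smul_smul, inv_mul_cancel₀ hv.ne', one_smul] at this
  have h2 := CFC.rpow_le_rpow (p := s) ⟨hs0, hs1⟩ (CStarAlgebra.rpow_neg_one_le_rpow_neg_one h1 hB')
  rw [CFC.rpow_rpow _ _ _ (by norm_num) hB', CFC.rpow_rpow _ _ _ (by norm_num) hvA,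
    neg_one_mul] at h2
  have hc : ∀ (f : ℝ → ℝ), ContinuousOn f (spectrum ℝ A) := fun f =>
    (Matrix.finite_real_spectrum (A := A)).continuousOn f
  have h3 : (v • A) ^ (-s) = (v ^ (-s)) • A ^ (-s) := by
    rw [CFC.rpow_eq_cfc_real hvA.nonneg, CFC.rpow_eq_cfc_real hA0, ← cfc_smul _ _ _ (hc _),
      ← cfc_comp_smul v (fun x : ℝ => x ^ (-s)) A
        (((Matrix.finite_real_spectrum (A := A)).image _).continuousOn _)]
    refine cfc_congr fun x hx => ?_
    have hx0 : 0 ≤ x := spectrum_nonneg_of_nonneg hA0 hx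
    simp [Real.mul_rpow hv.le hx0]
  rw [h3] at h2
  have h4 := smul_le_smul_of_nonneg_left h2 (Real.rpow_nonneg hv.le s)
  rw [smul_smul, ← Real.rpow_add hv, add_neg_cancel, Real.rpow_zero, one_smul] at h4
  rw [matRPow_eq_rpow _ hB.posSemidef, matRPow_eq_rpow _ (nonneg_iff_posSemidef.1 hA0)]
  exact h4

lemma specProj_isHermitian {m : Type*} [Fintype m] [DecidableEq m] {A : Matrix m m ℂ}
    (hA : A.IsHermitian) (μ : ℝ) : (specProj A μ).IsHermitian := by
  rw [specProj, matFun_eq_cfc _ hA]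
  exact cfc_predicate _ _

lemma sum_specProj {m : Type*} [Fintype m] [DecidableEq m] {A : Matrix m m ℂ}
    (hA : A.IsHermitian) : ∑ μ ∈ eigFinset A, specProj A μ = 1 := by
  simp only [specProj, matFun, dif_pos hA]
  rw [← Finset.sum_mul, ← Finset.mul_sum]
  have : ∑ μ ∈ eigFinset A, Matrix.diagonal
      (fun i => (((if hA.eigenvalues i = μ then 1 else 0 : ℝ)) : ℂ)) = 1 := by
    ext i j
    rw [Matrix.sum_apply]
    by_cases hij : i = j
    · subst hij
      have hmem : hA.eigenvalues i ∈ eigFinset A := by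
        rw [eigFinset, dif_pos hA]
        exact Finset.mem_image_of_mem _ (Finset.mem_univ i)
      simp only [Matrix.diagonal_apply_eq, Matrix.one_apply_eq]
      rw [Finset.sum_eq_single_of_mem _ hmem (fun b _ hb => by simp [hb.symm])]
      simp
    · simp [hij]
  rw [this, mul_one]
  exact Unitary.coe_mul_star_self _

lemma pinch_ge {m : Type*} [Fintype m] [DecidableEq m] {A B : Matrix m m ℂ}
    (hA : A.IsHermitian) (hB : B.PosSemidef) :
    (((numEig A : ℝ) : ℂ) • pinch A B - B).PosSemidef := by
  set P := specProj A
  have hP := specProj_isHermitian hA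
  have hps : (∑ i ∈ eigFinset A, ∑ j ∈ eigFinset A, (P i - P j) * B * (P i - P j)).PosSemidef := by
    refine Matrix.posSemidef_sum _ fun i _ => Matrix.posSemidef_sum _ fun j _ => ?_
    have := hB.mul_mul_conjTranspose_same (P i - P j)
    rwa [Matrix.conjTranspose_sub, (hP i).eq, (hP j).eq] at this
  have key : ∑ i ∈ eigFinset A, ∑ j ∈ eigFinset A, (P i - P j) * B * (P i - P j)
      = (2 : ℂ) • (((numEig A : ℝ) : ℂ) • pinch A B - B) := by
    have h1 : ∑ i ∈ eigFinset A, ∑ j ∈ eigFinset A, P i * B * P j = B := by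
      simp_rw [← Finset.mul_sum, ← Finset.sum_mul]
      rw [sum_specProj hA]; simp
    have h2 : ∑ i ∈ eigFinset A, ∑ j ∈ eigFinset A, P j * B * P i = B := by
      rw [Finset.sum_comm]; exact h1
    have h3 : ∑ i ∈ eigFinset A, ∑ _j ∈ eigFinset A, P i * B * P i
        = ((numEig A : ℝ) : ℂ) • pinch A B := by
      simp [numEig, pinch, P, Finset.smul_sum, Nat.cast_smul_eq_nsmul]
    have h4 : ∑ _i ∈ eigFinset A, ∑ j ∈ eigFinset A, P j * B * P j
        = ((numEig A : ℝ) : ℂ) • pinch A B := by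
      rw [Finset.sum_comm]; exact h3
    simp only [sub_mul, mul_sub, Finset.sum_sub_distrib]
    rw [h1, h2, h3, h4, two_smul]
    abel
  rw [key] at hps
  have := hps.smul (show (0 : ℂ) ≤ (2 : ℂ)⁻¹ by simp)
  rwa [smul_smul, inv_mul_cancel₀ two_ne_zero, one_smul] at this

lemma tensorPow_mul {d : ℕ} (A B : Matrix (Fin d) (Fin d) ℂ) (n : ℕ) :
    tensorPow (A * B) n = tensorPow A n * tensorPow B n := by
  ext x y
  simp only [tensorPow, Matrix.mul_apply, Finset.prod_univ_sum, Fintype.piFinset_univ,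
    Finset.prod_mul_distrib]

lemma tensorPow_one {d : ℕ} (n : ℕ) : tensorPow (1 : Matrix (Fin d) (Fin d) ℂ) n = 1 := by
  ext x y
  by_cases h : x = y
  · subst h; simp [tensorPow]
  · obtain ⟨i, hi⟩ := Function.ne_iff.1 h
    rw [Matrix.one_apply_ne h]
    exact Finset.prod_eq_zero (Finset.mem_univ i) (Matrix.one_apply_ne hi)

lemma tensorPow_conjTranspose {d : ℕ} (A : Matrix (Fin d) (Fin d) ℂ) (n : ℕ) :
    (tensorPow A n)ᴴ = tensorPow Aᴴ n := by
  ext x y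
  simp [tensorPow, Matrix.conjTranspose_apply]

open scoped MatrixOrder Matrix.Norms.L2Operator in
lemma tensorPow_posDef {d : ℕ} {A : Matrix (Fin d) (Fin d) ℂ} (hA : A.PosDef) (n : ℕ) :
    (tensorPow A n).PosDef := by
  have hu : IsUnit (tensorPow A n) := by
    obtain ⟨u, hu⟩ := hA.isUnit
    refine ⟨⟨tensorPow A n, tensorPow (↑u⁻¹) n, ?_, ?_⟩, rfl⟩
    · rw [← tensorPow_mul, ← hu, Units.mul_inv, tensorPow_one]
    · rw [← tensorPow_mul, ← hu, Units.inv_mul, tensorPow_one]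
  have hps : (tensorPow A n).PosSemidef := by
    obtain ⟨C, hC⟩ := CStarAlgebra.nonneg_iff_eq_star_mul_self.1 hA.posSemidef.nonneg
    rw [hC, tensorPow_mul, Matrix.star_eq_conjTranspose, ← tensorPow_conjTranspose]
    exact Matrix.posSemidef_conjTranspose_mul_self _
  exact hps.posDef_iff_isUnit.2 hu

/-- **Negative-power inequality for the pinching.** For `0 ≤ s ≤ 1`,
`E_{σ_n}(ρ_n)^{−s} ≤ v(σ_n)^s · ρ_n^{−s}` in the Loewner order. -/
theorem pinch_neg_power_inequality {d : ℕ} (hd : 0 < d) (ρ σ : Matrix (Fin d) (Fin d) ℂ)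
    (hρ : IsDensity ρ) (hσ : IsDensity σ) (hρpd : ρ.PosDef)
    (s : ℝ) (hs0 : 0 ≤ s) (hs1 : s ≤ 1) (n : ℕ) (hn : 1 ≤ n) :
    (((((numEig (tensorPow σ n) : ℝ)) ^ s : ℝ) : ℂ) • matRPow (tensorPow ρ n) (-s)
      - matRPow (pinch (tensorPow σ n) (tensorPow ρ n)) (-s)).PosSemidef := by
  have hH : (tensorPow σ n).IsHermitian := by
    rw [Matrix.IsHermitian, tensorPow_conjTranspose, hσ.1.1.eq]
  have hB := tensorPow_posDef hρpd n
  have : Nonempty (Fin d) := ⟨⟨0, hd⟩⟩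
  have hv : (0 : ℝ) < (numEig (tensorPow σ n) : ℝ) := by
    rw [Nat.cast_pos, numEig, Finset.card_pos, eigFinset, dif_pos hH]
    exact Finset.univ_nonempty.image _
  exact neg_power_of_le hB hv (pinch_ge hH hB.posSemidef) hs0 hs1

end
end
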